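/- Define an equivalence relation ∼ on \bar{ℕ}^ℓ by k ∼ k′ iff r(k) = r(k′) and π_{r(k)}(k) = π_{r(k)}(k′), where r(k) is the least r ≥ 0 with k_{r+1} = ∞ (convention k_{ℓ+1} = ∞). Then φ factors through the quotient to induce a map φ̃ : \bar{ℕ}^ℓ/∼ → Ê_∞ := {φ(k) : k ∈ \bar{ℕ}^ℓ}, and φ̃ is a homeomorphism, where \bar{ℕ}^ℓ carries the product topology coming from the one-point compactification \bar{ℕ} of ℕ, the quotient carries the quotient topology, and Ê_∞ carries the subspace topology from the product space {0,1}^E. -/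

import Mathlib

open scoped BigOperators

noncomputable section

/-- The Hilbert space `H = ℓ²(ℕ^ℓ × ℤ)`. -/
abbrev H (ℓ : ℕ) : Type := lp (fun _ : (Fin ℓ → ℕ) × ℤ => ℂ) 2

/-- The standard basis vector `e_{(a,z)}` of `H`. -/
noncomputable def basisVec (ℓ : ℕ) (a : Fin ℓ → ℕ) (z : ℤ) : H ℓ :=
  lp.single 2 (a, z) 1

/-- `IsBop ℓ B` says that for each `i : Fin (ℓ+1)`, `r : ℤ` and `m n : Fin ℓ → ℕ`,
`B i r m n` is the operator `B_{i+1}(r,m,n)` of the paper (paper index `i ∈ {1,…,ℓ+1}`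
is `i-1 : Fin (ℓ+1)` here).  For `k : Fin ℓ` (paper index `k+1 ≤ ℓ`) :
`B k r m n e_{(a,z)} = e_{(a',z+Σ_{j≤k}(m_j−n_j))}` if `a_j = n_j` for `j < k` and
`a_k ≥ n_k` (where `a'_j = m_j` for `j < k`, `a'_k = a_k − n_k + m_k`, `a'_j = a_j`
for `j > k`), and `= 0` otherwise; and
`B ℓ r m n e_{(a,z)} = e_{(m, z + r + Σ_j (m_j − n_j))}` if `a = n`, and `= 0` otherwise. -/
def IsBop (ℓ : ℕ)
    (B : Fin (ℓ + 1) → ℤ → (Fin ℓ → ℕ) → (Fin ℓ → ℕ) → (H ℓ →L[ℂ] H ℓ)) : Prop :=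
  (∀ (k : Fin ℓ) (r : ℤ) (m n : Fin ℓ → ℕ) (a : Fin ℓ → ℕ) (z : ℤ),
      B k.castSucc r m n (basisVec ℓ a z) =
        if (∀ j : Fin ℓ, j < k → a j = n j) ∧ n k ≤ a k then
          basisVec ℓ
            (fun j => if j < k then m j else if j = k then a k - n k + m k else a j)
            (z + ∑ j ∈ Finset.univ.filter (fun j : Fin ℓ => j ≤ k), ((m j : ℤ) - (n j : ℤ)))
        else 0) ∧
  (∀ (r : ℤ) (m n : Fin ℓ → ℕ) (a : Fin ℓ → ℕ) (z : ℤ),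
      B (Fin.last ℓ) r m n (basisVec ℓ a z) =
        if a = n then basisVec ℓ m (z + r + ∑ j, ((m j : ℤ) - (n j : ℤ))) else 0)

/-- The set of projections `E = {0} ∪ {p_i(m)}`, where `p_i(m) = B_i(0,m,m)`. -/
def Eset (ℓ : ℕ)
    (B : Fin (ℓ + 1) → ℤ → (Fin ℓ → ℕ) → (Fin ℓ → ℕ) → (H ℓ →L[ℂ] H ℓ)) :
    Set (H ℓ →L[ℂ] H ℓ) :=
  {0} ∪ {x | ∃ (i : Fin (ℓ + 1)) (m : Fin ℓ → ℕ), x = B i 0 m m}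

/-- A filter in `E`: a nonempty subset `A ⊆ E` with `0 ∉ A`, closed under (operator)
multiplication, and upward closed in `E` for the usual (Loewner) order on operators. -/
def IsFilterIn (ℓ : ℕ)
    (B : Fin (ℓ + 1) → ℤ → (Fin ℓ → ℕ) → (Fin ℓ → ℕ) → (H ℓ →L[ℂ] H ℓ))
    (A : Set (H ℓ →L[ℂ] H ℓ)) : Prop :=
  A.Nonempty ∧ A ⊆ Eset ℓ B ∧ (0 : H ℓ →L[ℂ] H ℓ) ∉ A ∧
    (∀ e ∈ A, ∀ f ∈ A, e * f ∈ A) ∧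
    (∀ e ∈ A, ∀ f ∈ Eset ℓ B, e ≤ f → f ∈ A)

/-- An ultrafilter in `E`: a filter maximal under inclusion. -/
def IsUltrafilterIn (ℓ : ℕ)
    (B : Fin (ℓ + 1) → ℤ → (Fin ℓ → ℕ) → (Fin ℓ → ℕ) → (H ℓ →L[ℂ] H ℓ))
    (A : Set (H ℓ →L[ℂ] H ℓ)) : Prop :=
  IsFilterIn ℓ B A ∧ ∀ A' : Set (H ℓ →L[ℂ] H ℓ), IsFilterIn ℓ B A' → A ⊆ A' → A' = A

/-- A character of `E`: a nonzero multiplicative map `E → {0,1}` (valued in `Bool`,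
with `&&` as multiplication) vanishing at `0`. -/
def IsCharacter (ℓ : ℕ)
    (B : Fin (ℓ + 1) → ℤ → (Fin ℓ → ℕ) → (Fin ℓ → ℕ) → (H ℓ →L[ℂ] H ℓ))
    (x : {e : H ℓ →L[ℂ] H ℓ // e ∈ Eset ℓ B} → Bool) : Prop :=
  (∃ e, x e = true) ∧
    (∀ (e f : {e : H ℓ →L[ℂ] H ℓ // e ∈ Eset ℓ B}) (h : e.val * f.val ∈ Eset ℓ B),
      x ⟨e.val * f.val, h⟩ = (x e && x f)) ∧
    (∀ h : (0 : H ℓ →L[ℂ] H ℓ) ∈ Eset ℓ B, x ⟨0, h⟩ = false)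

/-- `LeastInf ℓ k r` says that `r` is the least nonnegative integer such that
`k_{r+1} = ∞` (paper indexing, with the convention `k_{ℓ+1} = ∞`).  In the 0-indexed
formulation: `r ≤ ℓ`, `k r = ∞` if `r < ℓ`, and `k j ≠ ∞` for all `j < r`. -/
def LeastInf (ℓ : ℕ) (k : Fin ℓ → ℕ∞) (r : ℕ) : Prop :=
  r ≤ ℓ ∧ (∀ h : r < ℓ, k ⟨r, h⟩ = ⊤) ∧ ∀ j : Fin ℓ, (j : ℕ) < r → k j ≠ ⊤

/-- The support of the character `φ(k)`, `k ∈ ℕ̄^ℓ`: it contains `p_i(m)` (paper index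
`i ≤ ℓ`) iff `π_{i−1}(m) = π_{i−1}(k)` and `m_i ≤ k_i`, and `p_{ℓ+1}(m)` iff `m = k`. -/
def phiSupp (ℓ : ℕ)
    (B : Fin (ℓ + 1) → ℤ → (Fin ℓ → ℕ) → (Fin ℓ → ℕ) → (H ℓ →L[ℂ] H ℓ))
    (k : Fin ℓ → ℕ∞) : Set (H ℓ →L[ℂ] H ℓ) :=
  {x | (∃ (i : Fin ℓ) (m : Fin ℓ → ℕ), x = B i.castSucc 0 m m ∧
          (∀ j : Fin ℓ, j < i → (m j : ℕ∞) = k j) ∧ (m i : ℕ∞) ≤ k i) ∨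
       (∃ m : Fin ℓ → ℕ, x = B (Fin.last ℓ) 0 m m ∧ ∀ j : Fin ℓ, (m j : ℕ∞) = k j)}

open Classical in
/-- The character `φ(k) : E → {0,1}` associated to `k ∈ ℕ̄^ℓ`. -/
noncomputable def phi (ℓ : ℕ)
    (B : Fin (ℓ + 1) → ℤ → (Fin ℓ → ℕ) → (Fin ℓ → ℕ) → (H ℓ →L[ℂ] H ℓ))
    (k : Fin ℓ → ℕ∞) : {e : H ℓ →L[ℂ] H ℓ // e ∈ Eset ℓ B} → Bool :=
  fun e => decide (e.val ∈ phiSupp ℓ B k)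

/-- The equivalence relation `∼` on `ℕ̄^ℓ`: `k ∼ k'` iff they have the same least
index `r` with `k_{r+1} = ∞` and agree on the first `r` coordinates. -/
def krel (ℓ : ℕ) (k k' : Fin ℓ → ℕ∞) : Prop :=
  ∃ r : ℕ, LeastInf ℓ k r ∧ LeastInf ℓ k' r ∧
    ∀ j : Fin ℓ, (j : ℕ) < r → k j = k' j

/-- The set of `k ∈ ℕ̄^ℓ` with `k j = m j` for `j < i` and `m i ≤ k i` (the latter only when
`i < ℓ`). -/
def cylinder (ℓ : ℕ) (i : Fin (ℓ + 1)) (m : Fin ℓ → ℕ) : Set (Fin ℓ → ℕ∞) :=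
  {k | ∀ j : Fin ℓ, (j.castSucc < i → (m j : ℕ∞) = k j) ∧ (j.castSucc = i → (m j : ℕ∞) ≤ k j)}

/-- The coordinatewise inclusion `ℕ^ℓ → ℕ̄^ℓ`. -/
def natInclusion (ℓ : ℕ) : (Fin ℓ → ℕ) → (Fin ℓ → ℕ∞) :=
  Pi.map fun _ n => (n : ℕ∞)

lemma ENat.denseRange_natCast : DenseRange ((↑) : ℕ → ℕ∞) := by
  intro x
  induction x using ENat.recTopCoe with
  | top =>
    exact mem_closure_of_tendsto ENat.tendsto_natCast_nhds_top
      (Filter.Eventually.of_forall fun n => Set.mem_range_self n)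
  | coe n => exact subset_closure (Set.mem_range_self n)

lemma ENat.isClopen_singleton_natCast (n : ℕ) : IsClopen {x : ℕ∞ | (n : ℕ∞) = x} := by
  have h : {x : ℕ∞ | (n : ℕ∞) = x} = {(n : ℕ∞)} := by ext x; exact eq_comm
  rw [h]
  exact ⟨isClosed_singleton, ENat.isOpen_singleton (ENat.natCast_ne_top n)⟩

lemma ENat.isClopen_Ici_natCast (n : ℕ) : IsClopen {x : ℕ∞ | (n : ℕ∞) ≤ x} := by
  refine ⟨isClosed_Ici, ?_⟩
  cases n with
  | zero => simp
  | succ n =>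
    convert (isOpen_Ioi : IsOpen (Set.Ioi (n : ℕ∞))) using 1
    ext x
    simpa using ENat.add_one_le_iff (ENat.natCast_ne_top n)

lemma denseRange_natInclusion (ℓ : ℕ) : DenseRange (natInclusion ℓ) :=
  DenseRange.piMap fun _ => ENat.denseRange_natCast

lemma isClopen_cylinder (ℓ : ℕ) (i : Fin (ℓ + 1)) (m : Fin ℓ → ℕ) :
    IsClopen (cylinder ℓ i m) := by
  have h : cylinder ℓ i m = ⋂ j : Fin ℓ,
      {k : Fin ℓ → ℕ∞ |
        (j.castSucc < i → (m j : ℕ∞) = k j) ∧ (j.castSucc = i → (m j : ℕ∞) ≤ k j)} := by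
    ext k
    simp [cylinder]
  rw [h]
  refine isClopen_iInter_of_finite fun j => ?_
  have h₁ : IsClopen {k : Fin ℓ → ℕ∞ | (m j : ℕ∞) = k j} :=
    (ENat.isClopen_singleton_natCast (m j)).preimage (continuous_apply j)
  have h₂ : IsClopen {k : Fin ℓ → ℕ∞ | (m j : ℕ∞) ≤ k j} :=
    (ENat.isClopen_Ici_natCast (m j)).preimage (continuous_apply j)
  refine IsClopen.inter (s := {k : Fin ℓ → ℕ∞ | j.castSucc < i → (m j : ℕ∞) = k j})
    (t := {k : Fin ℓ → ℕ∞ | j.castSucc = i → (m j : ℕ∞) ≤ k j}) ?_ ?_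
  · by_cases hj : j.castSucc < i <;> simp [hj, h₁, isClopen_univ]
  · by_cases hj : j.castSucc = i <;> simp [hj, h₂, isClopen_univ]

lemma DenseRange.subset_of_preimage_subset {X Y : Type*} [TopologicalSpace Y] {f : X → Y}
    (hf : DenseRange f) {U V : Set Y} (hU : IsOpen U) (hV : IsClosed V)
    (h : f ⁻¹' U ⊆ f ⁻¹' V) : U ⊆ V := by
  refine (hf.open_subset_closure_inter hU).trans (closure_minimal ?_ hV)
  rintro _ ⟨hx, x, rfl⟩
  exact h hx

lemma DenseRange.eq_of_preimage_eq {X Y : Type*} [TopologicalSpace Y] {f : X → Y}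
    (hf : DenseRange f) {U V : Set Y} (hU : IsClopen U) (hV : IsClopen V)
    (h : f ⁻¹' U = f ⁻¹' V) : U = V :=
  (hf.subset_of_preimage_subset hU.isOpen hV.isClosed h.subset).antisymm
    (hf.subset_of_preimage_subset hV.isOpen hU.isClosed h.superset)

lemma cylinder_castSucc (ℓ : ℕ) (i : Fin ℓ) (m : Fin ℓ → ℕ) (k : Fin ℓ → ℕ∞) :
    k ∈ cylinder ℓ i.castSucc m ↔ (∀ j : Fin ℓ, j < i → (m j : ℕ∞) = k j) ∧ (m i : ℕ∞) ≤ k i := by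
  simp only [cylinder, Set.mem_ofPred_eq, Fin.castSucc_lt_castSucc_iff, Fin.castSucc_inj,
    forall_and, forall_eq]

lemma cylinder_last (ℓ : ℕ) (m : Fin ℓ → ℕ) (k : Fin ℓ → ℕ∞) :
    k ∈ cylinder ℓ (Fin.last ℓ) m ↔ ∀ j : Fin ℓ, (m j : ℕ∞) = k j := by
  simp [cylinder, Fin.castSucc_lt_last, Fin.castSucc_ne_last]

lemma basisVec_ne_zero (ℓ : ℕ) (a : Fin ℓ → ℕ) (z : ℤ) : basisVec ℓ a z ≠ 0 := by
  intro h
  have h₁ : (basisVec ℓ a z) (a, z) = 1 := lp.single_apply_self _ _ _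
  rw [h] at h₁
  exact zero_ne_one h₁

section Projections

variable {ℓ : ℕ} {B : Fin (ℓ + 1) → ℤ → (Fin ℓ → ℕ) → (Fin ℓ → ℕ) → (H ℓ →L[ℂ] H ℓ)}

open Classical in
lemma IsBop.apply_diag (hB : IsBop ℓ B) (i : Fin (ℓ + 1)) (m a : Fin ℓ → ℕ) (z : ℤ) :
    B i 0 m m (basisVec ℓ a z) =
      if natInclusion ℓ a ∈ cylinder ℓ i m then basisVec ℓ a z else 0 := by
  induction i using Fin.lastCases with
  | last =>
    rw [hB.2]
    refine if_ctx_congr ?_ (fun h => ?_) fun _ => rfl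
    · rw [cylinder_last]
      simp [natInclusion, funext_iff, eq_comm]
    · have h' : a = m := by
        rw [cylinder_last] at h
        funext j
        exact Nat.cast_injective (h j).symm
      simp [h']
  | cast i =>
    rw [hB.1]
    refine if_ctx_congr ?_ (fun h => ?_) fun _ => rfl
    · rw [cylinder_castSucc]
      simp [natInclusion, eq_comm]
    · have h' : (∀ j : Fin ℓ, j < i → m j = a j) ∧ m i ≤ a i := by
        rw [cylinder_castSucc] at h
        exact ⟨fun j hj => Nat.cast_injective (h.1 j hj), Nat.cast_le.1 h.2⟩
      have ha : (fun j => if j < i then m j else if j = i then a i - m i + m i else a j) = a := by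
        funext j
        split_ifs with h₁ h₂
        · exact h'.1 j h₁
        · rw [h₂, Nat.sub_add_cancel h'.2]
        · rfl
      rw [ha]
      simp

lemma IsBop.cylinder_eq (hB : IsBop ℓ B) {i i' : Fin (ℓ + 1)} {m m' : Fin ℓ → ℕ}
    (h : B i 0 m m = B i' 0 m' m') : cylinder ℓ i m = cylinder ℓ i' m' := by
  refine (denseRange_natInclusion ℓ).eq_of_preimage_eq (isClopen_cylinder ℓ i m)
    (isClopen_cylinder ℓ i' m') ?_
  ext a
  have ha := congrArg (fun T : H ℓ →L[ℂ] H ℓ => T (basisVec ℓ a 0)) h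
  simp only [hB.apply_diag] at ha
  have hne := basisVec_ne_zero ℓ a 0
  by_cases h₁ : natInclusion ℓ a ∈ cylinder ℓ i m <;>
    by_cases h₂ : natInclusion ℓ a ∈ cylinder ℓ i' m' <;>
    simp_all [eq_comm]

lemma mem_phiSupp_iff_exists (k : Fin ℓ → ℕ∞) (x : H ℓ →L[ℂ] H ℓ) :
    x ∈ phiSupp ℓ B k ↔ ∃ i m, x = B i 0 m m ∧ k ∈ cylinder ℓ i m := by
  constructor
  · rintro (⟨i, m, hx, h⟩ | ⟨m, hx, h⟩)
    · exact ⟨i.castSucc, m, hx, (cylinder_castSucc ℓ i m k).2 h⟩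
    · exact ⟨Fin.last ℓ, m, hx, (cylinder_last ℓ m k).2 h⟩
  · rintro ⟨i, m, hx, h⟩
    induction i using Fin.lastCases with
    | last => exact Or.inr ⟨m, hx, (cylinder_last ℓ m k).1 h⟩
    | cast i => exact Or.inl ⟨i, m, hx, (cylinder_castSucc ℓ i m k).1 h⟩

lemma IsBop.mem_phiSupp_iff (hB : IsBop ℓ B) (i : Fin (ℓ + 1)) (m : Fin ℓ → ℕ)
    (k : Fin ℓ → ℕ∞) : B i 0 m m ∈ phiSupp ℓ B k ↔ k ∈ cylinder ℓ i m := by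
  rw [mem_phiSupp_iff_exists]
  constructor
  · rintro ⟨i', m', h, hk⟩
    rwa [hB.cylinder_eq h]
  · exact fun hk => ⟨i, m, rfl, hk⟩

lemma IsBop.isClopen_setOf_mem_phiSupp (hB : IsBop ℓ B) (x : H ℓ →L[ℂ] H ℓ) :
    IsClopen {k | x ∈ phiSupp ℓ B k} := by
  by_cases hx : ∃ i m, x = B i 0 m m
  · obtain ⟨i, m, rfl⟩ := hx
    simpa only [hB.mem_phiSupp_iff, Set.ofPred_mem_eq] using isClopen_cylinder ℓ i m
  · have h : {k | x ∈ phiSupp ℓ B k} = ∅ := by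
      ext k
      simp only [mem_phiSupp_iff_exists, Set.mem_ofPred_eq, Set.mem_empty_iff_false, iff_false]
      rintro ⟨i, m, h, -⟩
      exact hx ⟨i, m, h⟩
    rw [h]
    exact isClopen_empty

lemma IsBop.continuous_phi (hB : IsBop ℓ B) : Continuous (phi ℓ B) := by
  refine continuous_pi fun e => ?_
  refine (continuous_bool_rng true).2 ?_
  convert hB.isClopen_setOf_mem_phiSupp e.val using 1
  ext k
  simp [phi]

lemma IsBop.phi_eq_iff (hB : IsBop ℓ B) (k k' : Fin ℓ → ℕ∞) :
    phi ℓ B k = phi ℓ B k' ↔ ∀ i m, k ∈ cylinder ℓ i m ↔ k' ∈ cylinder ℓ i m := by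
  constructor
  · intro h i m
    have h' := congrFun h ⟨B i 0 m m, Or.inr ⟨i, m, rfl⟩⟩
    simpa only [phi, decide_eq_decide, hB.mem_phiSupp_iff] using h'
  · intro h
    funext e
    simp only [phi, decide_eq_decide, mem_phiSupp_iff_exists, h]

end Projections

lemma exists_leastInf (ℓ : ℕ) (k : Fin ℓ → ℕ∞) : ∃ r, LeastInf ℓ k r := by
  classical
  have hex : ∃ r, ∀ h : r < ℓ, k ⟨r, h⟩ = ⊤ := ⟨ℓ, fun h => absurd h (lt_irrefl ℓ)⟩
  refine ⟨Nat.find hex, Nat.find_min' hex fun h => absurd h (lt_irrefl ℓ), Nat.find_spec hex,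
    fun j hj h => Nat.find_min hex hj fun _ => h⟩

lemma krel_symm {ℓ : ℕ} {k k' : Fin ℓ → ℕ∞} (h : krel ℓ k k') : krel ℓ k' k := by
  obtain ⟨r, h₁, h₂, h₃⟩ := h
  exact ⟨r, h₂, h₁, fun j hj => (h₃ j hj).symm⟩

lemma mem_cylinder_of_krel {ℓ : ℕ} {k k' : Fin ℓ → ℕ∞} (h : krel ℓ k k') {i : Fin (ℓ + 1)}
    {m : Fin ℓ → ℕ} (hk : k ∈ cylinder ℓ i m) : k' ∈ cylinder ℓ i m := by
  obtain ⟨r, ⟨hr, htop, -⟩, ⟨-, htop', -⟩, heq⟩ := h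
  have hir : (i : ℕ) ≤ r := by
    by_contra! hlt
    have hrℓ : r < ℓ := by omega
    have := (hk ⟨r, hrℓ⟩).1 (by simpa [Fin.lt_def] using hlt)
    rw [htop hrℓ] at this
    exact ENat.natCast_ne_top _ this
  have key : ∀ j : Fin ℓ, (j : ℕ) ≤ r → k j = k' j := by
    intro j hj
    rcases hj.lt_or_eq with hj | hj
    · exact heq j hj
    · subst hj
      exact (htop j.isLt).trans (htop' j.isLt).symm
  intro j
  constructor
  · intro hj
    rw [← key j ((Fin.lt_def.1 hj).le.trans hir)]
    exact (hk j).1 hj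
  · intro hj
    rw [← key j (by rw [← hj] at hir; exact hir)]
    exact (hk j).2 hj

lemma eq_of_mem_cylinder_iff {ℓ : ℕ} {k k' : Fin ℓ → ℕ∞}
    (h : ∀ i m, k ∈ cylinder ℓ i m ↔ k' ∈ cylinder ℓ i m) (i : Fin ℓ)
    (hfin : ∀ j < i, k j ≠ ⊤) : k i = k' i := by
  induction i using WellFoundedLT.induction with
  | ind i ih =>
  have heq : ∀ j < i, k j = k' j := fun j hj => ih j hj fun l hl => hfin l (hl.trans hj)
  refine ENat.eq_of_forall_natCast_le_iff fun n => ?_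
  have hn := h i.castSucc (Function.update (fun j => (k j).toNat) i n)
  simp only [cylinder_castSucc, Function.update_self] at hn
  have hm : ∀ j < i, ((Function.update (fun j => (k j).toNat) i n j : ℕ) : ℕ∞) = k j := by
    intro j hj
    rw [Function.update_of_ne hj.ne]
    exact ENat.natCast_toNat (hfin j hj)
  have hm' : ∀ j < i, ((Function.update (fun j => (k j).toNat) i n j : ℕ) : ℕ∞) = k' j :=
    fun j hj => (hm j hj).trans (heq j hj)
  exact ⟨fun h₁ => (hn.1 ⟨hm, h₁⟩).2, fun h₁ => (hn.2 ⟨hm', h₁⟩).2⟩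

lemma krel_iff_mem_cylinder_iff {ℓ : ℕ} {k k' : Fin ℓ → ℕ∞} :
    krel ℓ k k' ↔ ∀ i m, k ∈ cylinder ℓ i m ↔ k' ∈ cylinder ℓ i m := by
  refine ⟨fun h i m => ⟨mem_cylinder_of_krel h, mem_cylinder_of_krel (krel_symm h)⟩, fun h => ?_⟩
  obtain ⟨r, hr, htop, hfin⟩ := exists_leastInf ℓ k
  have heq : ∀ j : Fin ℓ, (j : ℕ) ≤ r → k j = k' j := fun j hj =>
    eq_of_mem_cylinder_iff h j fun l hl => hfin l ((Fin.lt_def.1 hl).trans_le hj)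
  refine ⟨r, ⟨hr, htop, hfin⟩, ⟨hr, fun hlt => ?_, fun j hj => ?_⟩, fun j hj => heq j hj.le⟩
  · rw [← heq ⟨r, hlt⟩ le_rfl, htop hlt]
  · rw [← heq j hj.le]
    exact hfin j hj

/-- `φ` factors through the quotient `ℕ̄^ℓ/∼` and induces a homeomorphism
`φ̃ : ℕ̄^ℓ/∼ ≃ Ê_∞ = {φ(k)}`, where the quotient carries the quotient topology and
`Ê_∞` the subspace topology from `{0,1}^E`. -/
theorem phi_quotient_homeomorph (ℓ : ℕ) (hℓ : 1 ≤ ℓ)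
    (B : Fin (ℓ + 1) → ℤ → (Fin ℓ → ℕ) → (Fin ℓ → ℕ) → (H ℓ →L[ℂ] H ℓ))
    (hB : IsBop ℓ B) :
    ∃ ψ : Quot (krel ℓ) ≃ₜ {x // x ∈ Set.range (phi ℓ B)},
      ∀ k : Fin ℓ → ℕ∞, (ψ (Quot.mk (krel ℓ) k) : _) = phi ℓ B k := by
  have hiff : ∀ k k', phi ℓ B k = phi ℓ B k' ↔ krel ℓ k k' := fun k k' =>
    (hB.phi_eq_iff k k').trans krel_iff_mem_cylinder_iff.symm
  let f : Quot (krel ℓ) → {x // x ∈ Set.range (phi ℓ B)} :=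
    Quot.lift (fun k => ⟨phi ℓ B k, k, rfl⟩) fun k k' h => Subtype.ext ((hiff k k').2 h)
  have hf : Function.Bijective f := by
    constructor
    · rintro ⟨k⟩ ⟨k'⟩ h
      exact Quot.sound ((hiff k k').1 (congrArg Subtype.val h))
    · rintro ⟨_, k, rfl⟩
      exact ⟨Quot.mk _ k, rfl⟩
  have hcont : Continuous (Equiv.ofBijective f hf) :=
    continuous_quot_lift _ (hB.continuous_phi.subtype_mk _)
  exact ⟨hcont.homeoOfEquivCompactToT2, fun k => rfl⟩
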